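/- arXiv:1503.00876 — 3 statements merged into one kernel-verified Lean document; each statement's English description precedes it below -/
import Mathlib

section
/- Let C be a ℚ-linear preadditive category, let X, Y be objects, let p : X → Y and q : Y → X be morphisms, and let N ∈ ℚ be nonzero with p ∘ q = N · 1_Y. Let π_X be a Chow–Künneth family on X such that q ∘ p commutes with π_X i for every i ∈ ℤ. Then the family π_Y i := N^{−1} · (p ∘ π_X i ∘ q) is a Chow–Künneth family on Y: each π_Y i is idempotent, π_Y i ∘ π_Y j = 0 for i ≠ j, and ∑_i π_Y i = 1_Y. (This is the descent of Chow–Künneth decompositions along a generically finite morphism, the core computation of the paper's Proposition 1.8.) -/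
open CategoryTheory

/-- A Chow–Künneth family on an object `X` of a preadditive category: a finitely
supported function `π : ℤ → End(X)` consisting of pairwise orthogonal idempotents
summing to the identity. -/
def IsCKFamily {C : Type*} [Category C] [Preadditive C] {X : C}
    (π : ℤ → (X ⟶ X)) : Prop :=
  (∀ i, π i ≫ π i = π i) ∧ (∀ i j, i ≠ j → π i ≫ π j = 0) ∧
    {i | π i ≠ 0}.Finite ∧ (∑ᶠ i, π i = 𝟙 X)

/-- If `p ≫ q` commutes with `f` and `q ≫ p = N • 𝟙 Y`, then conjugation by `q` and `p` is
multiplicative up to the factor `N`. -/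
theorem conj_comp_conj_of_comm {R C : Type*} [Semiring R] [Category C] [Preadditive C] [Linear R C]
    {X Y : C} {p : X ⟶ Y} {q : Y ⟶ X} {N : R} (hpq : q ≫ p = N • 𝟙 Y) {f : X ⟶ X}
    (hf : (p ≫ q) ≫ f = f ≫ p ≫ q) (g : X ⟶ X) :
    (q ≫ f ≫ p) ≫ q ≫ g ≫ p = N • (q ≫ (f ≫ g) ≫ p) := by
  calc (q ≫ f ≫ p) ≫ q ≫ g ≫ p = q ≫ (f ≫ p ≫ q) ≫ g ≫ p := by simp only [Category.assoc]
    _ = (q ≫ p) ≫ q ≫ (f ≫ g) ≫ p := by rw [← hf]; simp only [Category.assoc]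
    _ = N • (q ≫ (f ≫ g) ≫ p) := by rw [hpq, Linear.smul_comp, Category.id_comp]

/-- Descent of Chow–Künneth decompositions along a generically finite morphism
(core of the paper's Proposition 1.8): if `p ∘ q = N·1_Y` and `q ∘ p` commutes with
all the projectors `π_X i`, then `π_Y i := N⁻¹·(p ∘ π_X i ∘ q)` is a Chow–Künneth
family on `Y`. -/
theorem isCKFamily_descent {C : Type*} [Category C] [Preadditive C] [Linear ℚ C]
    {X Y : C} (p : X ⟶ Y) (q : Y ⟶ X) (N : ℚ) (hN : N ≠ 0)
    (hpq : q ≫ p = N • 𝟙 Y)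
    (πX : ℤ → (X ⟶ X)) (hCK : IsCKFamily πX)
    (hcomm : ∀ i : ℤ, (p ≫ q) ≫ πX i = πX i ≫ (p ≫ q)) :
    IsCKFamily (fun i => N⁻¹ • (q ≫ πX i ≫ p)) := by
  obtain ⟨hidem, horth, hfin, hsum⟩ := hCK
  have hmul : ∀ i j, (N⁻¹ • (q ≫ πX i ≫ p)) ≫ (N⁻¹ • (q ≫ πX j ≫ p)) =
      N⁻¹ • (q ≫ (πX i ≫ πX j) ≫ p) := fun i j => by
    rw [Linear.smul_comp, Linear.comp_smul, conj_comp_conj_of_comm hpq (hcomm i),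
      inv_smul_smul₀ hN]
  refine ⟨fun i => ?_, fun i j hij => ?_, hfin.subset fun i hi h => hi ?_, ?_⟩
  · simp only [hmul, hidem]
  · simp only [hmul, horth i j hij, Limits.zero_comp, Limits.comp_zero, smul_zero]
  · simp only [h, Limits.zero_comp, Limits.comp_zero, smul_zero]
  · let φ : (X ⟶ X) →+ (Y ⟶ Y) := (Preadditive.leftComp Y q).comp (Preadditive.rightComp X p)
    have hφ : ∑ᶠ i, q ≫ πX i ≫ p = q ≫ 𝟙 X ≫ p := by
      rw [← hsum]
      exact (φ.map_finsum hfin).symm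
    rw [← smul_finsum, hφ, Category.id_comp, hpq, inv_smul_smul₀ hN]
end

section
/- Let C be a ℚ-linear preadditive category, let X, Y be objects, let p : X → Y and q : Y → X be morphisms, and let N ∈ ℚ be nonzero with p ∘ q = N · 1_Y. Let π_X be a Chow–Künneth family on X such that q ∘ p commutes with π_X i for every i ∈ ℤ, and set π_Y i := N^{−1} · (p ∘ π_X i ∘ q). Then for every i ∈ ℤ one has π_Y i ∘ p = p ∘ π_X i and q ∘ π_Y i = π_X i ∘ q; in particular π_Y j ∘ p ∘ π_X i = 0 for all i ≠ j. (This is the assertion of the paper's Proposition 1.8 that the morphism p is of pure grade 0.) -/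
open CategoryTheory

/-- The paper's Proposition 1.8: with `π_Y i := N⁻¹·(p ∘ π_X i ∘ q)`, the morphism `p`
is of pure grade 0, i.e. `π_Y i ∘ p = p ∘ π_X i` and `q ∘ π_Y i = π_X i ∘ q` for all
`i`; in particular `π_Y j ∘ p ∘ π_X i = 0` for `i ≠ j`. -/
theorem descent_pure_grade_zero {C : Type*} [Category C] [Preadditive C] [Linear ℚ C]
    {X Y : C} (p : X ⟶ Y) (q : Y ⟶ X) (N : ℚ) (hN : N ≠ 0)
    (hpq : q ≫ p = N • 𝟙 Y)
    (πX : ℤ → (X ⟶ X)) (hCK : IsCKFamily πX)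
    (hcomm : ∀ i : ℤ, (p ≫ q) ≫ πX i = πX i ≫ (p ≫ q)) :
    (∀ i : ℤ, p ≫ (N⁻¹ • (q ≫ πX i ≫ p)) = πX i ≫ p) ∧
    (∀ i : ℤ, (N⁻¹ • (q ≫ πX i ≫ p)) ≫ q = q ≫ πX i) ∧
    (∀ i j : ℤ, i ≠ j → πX i ≫ p ≫ (N⁻¹ • (q ≫ πX j ≫ p)) = 0) := by
  have hp (i : ℤ) : p ≫ (N⁻¹ • (q ≫ πX i ≫ p)) = πX i ≫ p := by
    have h : p ≫ q ≫ πX i ≫ p = N • (πX i ≫ p) := by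
      calc p ≫ q ≫ πX i ≫ p = ((p ≫ q) ≫ πX i) ≫ p := by simp only [Category.assoc]
        _ = πX i ≫ p ≫ (q ≫ p) := by rw [hcomm]; simp only [Category.assoc]
        _ = N • (πX i ≫ p) := by
          rw [hpq, Linear.comp_smul, Category.comp_id, Linear.comp_smul]
    rw [Linear.comp_smul, h, inv_smul_smul₀ hN]
  have hq (i : ℤ) : (N⁻¹ • (q ≫ πX i ≫ p)) ≫ q = q ≫ πX i := by
    have h : (q ≫ πX i ≫ p) ≫ q = N • (q ≫ πX i) := by
      calc (q ≫ πX i ≫ p) ≫ q = q ≫ (πX i ≫ (p ≫ q)) := by simp only [Category.assoc]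
        _ = (q ≫ p) ≫ q ≫ πX i := by rw [← hcomm]; simp only [Category.assoc]
        _ = N • (q ≫ πX i) := by rw [hpq, Linear.smul_comp, Category.id_comp]
    rw [Linear.smul_comp, h, inv_smul_smul₀ hN]
  refine ⟨hp, hq, fun i j hij => ?_⟩
  rw [hp, ← Category.assoc, hCK.2.1 i j hij, Limits.zero_comp]
end

section
/- Let C be a ℚ-linear preadditive category, let X, Y be objects, let G be a finite group, and let ρ : G → End(X) be a monoid homomorphism (into the composition monoid of endomorphisms). Let p : X → Y and q : Y → X satisfy p ∘ q = |G| · 1_Y and q ∘ p = ∑_{g ∈ G} ρ(g). Let π_X be a Chow–Künneth family on X such that ρ(g) commutes with π_X i for every g ∈ G and every i ∈ ℤ. Then the family π_Y i := |G|^{−1} · (p ∘ π_X i ∘ q) is a Chow–Künneth family on Y. (This is the core of the paper's Corollary 1.9: a G-invariant self-dual Chow–Künneth decomposition descends to the quotient X/G, for which {}^tΓ_p ∘ Γ_p = ∑_{g∈G} g.) -/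
open CategoryTheory

/-- If `q ≫ p = n • 𝟙 Y` and `p ≫ q` commutes with `a`, then `f ↦ n⁻¹ • (q ≫ f ≫ p)` is
compatible with the composite `a ≫ b`. -/
lemma inv_smul_conj_comp {C : Type*} [Category C] [Preadditive C] {K : Type*} [Field K]
    [Linear K C] {X Y : C} {n : K} (hn : n ≠ 0) {p : X ⟶ Y} {q : Y ⟶ X}
    (hpq : q ≫ p = n • 𝟙 Y) {a : X ⟶ X} (ha : (p ≫ q) ≫ a = a ≫ p ≫ q) (b : X ⟶ X) :
    (n⁻¹ • (q ≫ a ≫ p)) ≫ (n⁻¹ • (q ≫ b ≫ p)) = n⁻¹ • (q ≫ (a ≫ b) ≫ p) := by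
  have h : (q ≫ a ≫ p) ≫ (q ≫ b ≫ p) = n • (q ≫ (a ≫ b) ≫ p) := calc
    _ = q ≫ (a ≫ p ≫ q) ≫ b ≫ p := by simp only [Category.assoc]
    _ = (q ≫ p) ≫ q ≫ (a ≫ b) ≫ p := by rw [← ha]; simp only [Category.assoc]
    _ = _ := by rw [hpq, Linear.smul_comp, Category.id_comp]
  rw [Linear.smul_comp, Linear.comp_smul, h, inv_smul_smul₀ hn]

/-- Core of the paper's Corollary 1.9: let `G` be a finite group acting on `X` through
a monoid homomorphism `ρ : G → End(X)`, and let `p : X ⟶ Y`, `q : Y ⟶ X` satisfy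
`p ∘ q = |G|·1_Y` and `q ∘ p = ∑_{g∈G} ρ(g)` (as for the quotient morphism `X → X/G`).
If a Chow–Künneth family `π_X` on `X` is `G`-invariant, i.e. each `ρ(g)` commutes with
each `π_X i`, then `π_Y i := |G|⁻¹·(p ∘ π_X i ∘ q)` is a Chow–Künneth family on `Y`. -/
theorem isCKFamily_quotient_descent {C : Type*} [Category C] [Preadditive C]
    [Linear ℚ C] {X Y : C} (G : Type*) [Group G] [Fintype G]
    (ρ : G →* CategoryTheory.End X)
    (p : X ⟶ Y) (q : Y ⟶ X)
    (hpq : q ≫ p = (Fintype.card G : ℚ) • 𝟙 Y)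
    (hqp : p ≫ q = ∑ g : G, (ρ g : X ⟶ X))
    (πX : ℤ → (X ⟶ X)) (hCK : IsCKFamily πX)
    (hinv : ∀ (g : G) (i : ℤ), (ρ g : X ⟶ X) ≫ πX i = πX i ≫ (ρ g : X ⟶ X)) :
    IsCKFamily (fun i => ((Fintype.card G : ℚ))⁻¹ • (q ≫ πX i ≫ p)) := by
  obtain ⟨hidem, horth, hfin, hsum⟩ := hCK
  have hn : (Fintype.card G : ℚ) ≠ 0 := Nat.cast_ne_zero.mpr Fintype.card_ne_zero
  have hcomm (i : ℤ) : (p ≫ q) ≫ πX i = πX i ≫ p ≫ q := by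
    rw [hqp, Preadditive.sum_comp, Preadditive.comp_sum]
    exact Finset.sum_congr rfl fun g _ => hinv g i
  refine ⟨fun i => ?_, fun i j hij => ?_, hfin.subset fun i hi h => hi ?_, ?_⟩
  · rw [inv_smul_conj_comp hn hpq (hcomm i), hidem]
  · rw [inv_smul_conj_comp hn hpq (hcomm i), horth i j hij, Limits.zero_comp, Limits.comp_zero,
      smul_zero]
  · simp only [h, Limits.zero_comp, Limits.comp_zero, smul_zero]
  · let φ : (X ⟶ X) →+ (Y ⟶ Y) :=
      (Preadditive.leftComp Y q).comp (Preadditive.rightComp X p)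
    have hφ : ∑ᶠ i, q ≫ πX i ≫ p = q ≫ (∑ᶠ i, πX i) ≫ p := (φ.map_finsum hfin).symm
    rw [← smul_finsum, hφ, hsum, Category.id_comp, hpq, inv_smul_smul₀ hn]
end
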